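/- Let n ≥ 3 be an integer and let μ, a, b, p, q be real constants with μ ≥ 0, b ≥ 0 and q ≥ 1. Assume one of the following holds: (1) a > 0 and −1 ≤ p < 4/(n−1); (2) a = 0, μ + b ≠ 0 and p ≥ −1; (3) a < 0, b = μ = 0 and p > 0. Then there is no smooth function v : ℝⁿ → ℝ with v > 0 everywhere satisfying Δv + μ·v + a·v^{p+1} + b·v^{1−q} = 0 on all of ℝⁿ. (This is the Euclidean case of Corollary 1, since ℝⁿ is a noncompact complete manifold with nonnegative Ricci curvature.) -/

import Mathlib

open Real

/-- The Euclidean Laplace operator: sum of second partial derivatives. -/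
noncomputable def lap {n : ℕ} (v : EuclideanSpace ℝ (Fin n) → ℝ)
    (x : EuclideanSpace ℝ (Fin n)) : ℝ :=
  ∑ i, fderiv ℝ (fun y => fderiv ℝ v y (EuclideanSpace.single i 1)) x
    (EuclideanSpace.single i 1)

/-- Partial derivative. -/
noncomputable def pd {n : ℕ} (i : Fin n) (g : EuclideanSpace ℝ (Fin n) → ℝ)
    (x : EuclideanSpace ℝ (Fin n)) : ℝ :=
  fderiv ℝ g x (EuclideanSpace.single i 1)

/-- Smooth functions. -/
abbrev Sm {n : ℕ} (g : EuclideanSpace ℝ (Fin n) → ℝ) : Prop := ContDiff ℝ (⊤ : ℕ∞) g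

section calc_rules

variable {n : ℕ} {g h : EuclideanSpace ℝ (Fin n) → ℝ}

theorem Sm.da (hg : Sm g) (x) : DifferentiableAt ℝ g x :=
  (hg.differentiable (by simp)) x

theorem pd_smooth (hg : Sm g) (i : Fin n) : Sm (pd i g) := by
  have h1 : ContDiff ℝ (⊤ : ℕ∞) (fderiv ℝ g) := hg.fderiv_right (by simp)
  exact h1.clm_apply contDiff_const

theorem lap_eq (x : EuclideanSpace ℝ (Fin n)) : lap g x = ∑ i, pd i (pd i g) x := rfl

theorem pd_comm (hg : Sm g) (i j : Fin n) (x) : pd i (pd j g) x = pd j (pd i g) x := by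
  have h1 : ContDiff ℝ (⊤ : ℕ∞) (fderiv ℝ g) := hg.fderiv_right (by simp)
  have hd : DifferentiableAt ℝ (fderiv ℝ g) x := (h1.differentiable (by simp)) x
  have key : ∀ i j : Fin n, pd i (pd j g) x =
      fderiv ℝ (fderiv ℝ g) x (EuclideanSpace.single i 1) (EuclideanSpace.single j 1) := by
    intro i j
    have : pd j g = fun y => (fderiv ℝ g y) (EuclideanSpace.single j 1) := rfl
    unfold pd at this ⊢
    rw [fderiv_clm_apply hd (differentiableAt_const _)]
    simp
  rw [key, key]
  have hs : IsSymmSndFDerivAt ℝ g x := hg.contDiffAt.isSymmSndFDerivAt (by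
    rw [minSmoothness_of_isRCLikeNormedField]
    exact WithTop.coe_le_coe.2 (le_top : (2 : ℕ∞) ≤ ⊤))
  exact hs _ _

theorem pd_mul (hg : Sm g) (hh : Sm h) (i : Fin n) (x) :
    pd i (fun y => g y * h y) x = g x * pd i h x + h x * pd i g x := by
  unfold pd
  rw [fderiv_fun_mul (hg.da x) (hh.da x)]
  simp

theorem pd_add (hg : Sm g) (hh : Sm h) (i : Fin n) (x) :
    pd i (fun y => g y + h y) x = pd i g x + pd i h x := by
  unfold pd
  rw [fderiv_fun_add (hg.da x) (hh.da x)]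
  simp

theorem pd_sub (hg : Sm g) (hh : Sm h) (i : Fin n) (x) :
    pd i (fun y => g y - h y) x = pd i g x - pd i h x := by
  unfold pd
  rw [fderiv_fun_sub (hg.da x) (hh.da x)]
  simp

theorem pd_neg (i : Fin n) (x) :
    pd i (fun y => - g y) x = - pd i g x := by
  unfold pd
  rw [fderiv_fun_neg]
  simp

theorem pd_const (c : ℝ) (i : Fin n) (x) : pd i (fun _ => c) x = 0 := by
  unfold pd
  simp

theorem pd_cmul (hg : Sm g) (c : ℝ) (i : Fin n) (x) :
    pd i (fun y => c * g y) x = c * pd i g x := by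
  rw [pd_mul contDiff_const hg, pd_const]; ring

theorem pd_sum {ι : Type*} (s : Finset ι) (G : ι → EuclideanSpace ℝ (Fin n) → ℝ)
    (hG : ∀ k, Sm (G k)) (i : Fin n) (x) :
    pd i (fun y => ∑ k ∈ s, G k y) x = ∑ k ∈ s, pd i (G k) x := by
  unfold pd
  rw [fderiv_fun_sum (fun k _ => (hG k).da x)]
  simp

theorem pd_exp (hg : Sm g) (i : Fin n) (x) :
    pd i (fun y => exp (g y)) x = exp (g x) * pd i g x := by
  unfold pd
  rw [fderiv_exp (hg.da x)]
  simp

theorem sm_coord (j : Fin n) : Sm (fun y : EuclideanSpace ℝ (Fin n) => y j) :=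
  (EuclideanSpace.proj (𝕜 := ℝ) j).contDiff

theorem pd_coord (i j : Fin n) (x : EuclideanSpace ℝ (Fin n)) :
    pd i (fun y : EuclideanSpace ℝ (Fin n) => y j) x = if i = j then 1 else 0 := by
  unfold pd
  have : (fun y : EuclideanSpace ℝ (Fin n) => y j) = (EuclideanSpace.proj (𝕜 := ℝ) j) := rfl
  rw [this, ContinuousLinearMap.fderiv]
  simp [eq_comm]

theorem pd_max (hg : Sm g) {x} (hm : IsLocalMax g x) (i : Fin n) :
    pd i g x = 0 ∧ pd i (pd i g) x ≤ 0 := by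
  have hz : ∀ y, pd i g y = fderiv ℝ g y (EuclideanSpace.single i 1) := fun _ => rfl
  refine ⟨by rw [hz, hm.fderiv_eq_zero]; simp, ?_⟩
  by_contra hpos
  push Not at hpos
  set e : EuclideanSpace ℝ (Fin n) := EuclideanSpace.single i 1
  have hline : ∀ t : ℝ, HasDerivAt (fun t : ℝ => x + t • e) e t := by
    intro t
    simpa using ((hasDerivAt_id t).smul_const e).const_add x
  have hder : ∀ k : EuclideanSpace ℝ (Fin n) → ℝ, Sm k → ∀ t : ℝ,
      HasDerivAt (fun t : ℝ => k (x + t • e)) (pd i k (x + t • e)) t := by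
    intro k hk t
    exact ((hk.da (x + t • e)).hasFDerivAt).comp_hasDerivAt t (hline t)
  have hd1 : deriv (fun t : ℝ => g (x + t • e)) = fun t => pd i g (x + t • e) :=
    funext fun t => (hder g hg t).deriv
  have hd2 : deriv (deriv (fun t : ℝ => g (x + t • e))) 0 = pd i (pd i g) x := by
    rw [hd1, (hder _ (pd_smooth hg i) 0).deriv]; simp
  have hmax : IsLocalMax (fun t : ℝ => g (x + t • e)) 0 := by
    have hc : ContinuousAt (fun t : ℝ => x + t • e) 0 := (hline 0).continuousAt
    have h0 : x + (0 : ℝ) • e = x := by simp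
    have := hc.tendsto
    rw [h0] at this
    have h2 := this.eventually hm
    unfold IsLocalMax IsMaxFilter
    simpa only [h0] using h2
  have hmin : IsLocalMin (fun t : ℝ => g (x + t • e)) 0 := by
    apply isLocalMin_of_deriv_deriv_pos
    · rw [hd2]; exact hpos
    · exact hmax.deriv_eq_zero
    · exact (hder g hg 0).continuousAt
  have hconst : (fun t : ℝ => g (x + t • e)) =ᶠ[nhds 0] fun _ => g (x + (0 : ℝ) • e) := by
    filter_upwards [hmax, hmin] with t h1 h2
    exact le_antisymm h1 h2
  have := hconst.deriv.deriv_eq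
  rw [hd2] at this
  simp at this
  linarith

end calc_rules

/-- Bochner formula. -/
theorem bochner {n : ℕ} {w : EuclideanSpace ℝ (Fin n) → ℝ} (hw : Sm w) (x) :
    lap (fun y => ∑ i, pd i w y * pd i w y) x =
      2 * (∑ i, ∑ j, (pd j (pd i w) x) ^ 2) + 2 * ∑ i, pd i w x * pd i (lap w) x := by
  have h1 : ∀ i, Sm (pd i w) := pd_smooth hw
  have h2 : ∀ i j, Sm (pd j (pd i w)) := fun i j => pd_smooth (h1 i) j
  have e1 : ∀ j, pd j (fun y => ∑ i, pd i w y * pd i w y) =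
      fun y => ∑ i, 2 * (pd i w y * pd j (pd i w) y) := by
    intro j; ext y
    rw [pd_sum _ _ (fun k => (h1 k).mul (h1 k))]
    refine Finset.sum_congr rfl fun i _ => ?_
    rw [pd_mul (h1 i) (h1 i)]; ring
  have e2 : ∀ j, pd j (pd j (fun y => ∑ i, pd i w y * pd i w y)) x =
      ∑ i, (2 * (pd j (pd i w) x)^2 + 2 * (pd i w x * pd j (pd j (pd i w)) x)) := by
    intro j
    rw [e1, pd_sum _ _ (fun k => contDiff_const.mul ((h1 k).mul (h2 k j)))]
    refine Finset.sum_congr rfl fun i _ => ?_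
    rw [pd_cmul ((h1 i).mul (h2 i j)), pd_mul (h1 i) (h2 i j)]; ring
  have e3 : ∀ i, pd i (lap w) x = ∑ j, pd j (pd j (pd i w)) x := by
    intro i
    have : lap w = fun y => ∑ j, pd j (pd j w) y := rfl
    rw [this, pd_sum _ _ (fun k => h2 k k)]
    refine Finset.sum_congr rfl fun j _ => ?_
    rw [pd_comm (h1 j)]
    have : pd i (pd j w) = pd j (pd i w) := funext fun y => pd_comm hw i j y
    rw [this]
  rw [lap_eq]
  simp_rw [e2, e3]
  rw [Finset.sum_comm, Finset.mul_sum, Finset.mul_sum, ← Finset.sum_add_distrib]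
  refine Finset.sum_congr rfl fun i _ => ?_
  rw [Finset.sum_add_distrib, Finset.mul_sum, Finset.mul_sum, Finset.mul_sum]

/-- Refined Cauchy-Schwarz inequality for the Hessian. -/
theorem hess_ineq {n : ℕ} (H : Fin n → Fin n → ℝ) (e : Fin n → ℝ) (he : ∑ i, e i * e i = 1) :
    ((∑ i, H i i) - ∑ i, ∑ j, e i * e j * H i j) ^ 2 ≤
      ((n : ℝ) - 1) * ∑ i, ∑ j, (H i j) ^ 2 := by
  have cs := Finset.sum_mul_sq_le_sq_mul_sq (Finset.univ : Finset (Fin n × Fin n))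
    (fun z => (if z.1 = z.2 then (1 : ℝ) else 0) - e z.1 * e z.2) (fun z => H z.1 z.2)
  simp only [Fintype.sum_prod_type] at cs
  have e1 : ∑ i, ∑ j, ((if i = j then (1 : ℝ) else 0) - e i * e j) * H i j =
      (∑ i, H i i) - ∑ i, ∑ j, e i * e j * H i j := by
    simp [sub_mul, Finset.sum_sub_distrib]
  have e2 : ∑ i, ∑ j, ((if i = j then (1 : ℝ) else 0) - e i * e j) ^ 2 = (n : ℝ) - 1 := by
    have : ∀ i j, ((if i = j then (1 : ℝ) else 0) - e i * e j) ^ 2 =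
        (if i = j then (1 - 2 * (e i * e j)) else 0) + (e i * e i) * (e j * e j) := by
      intro i j; split_ifs <;> ring
    simp_rw [this, Finset.sum_add_distrib, ← Finset.mul_sum, ← Finset.sum_mul, he]
    simp [Finset.sum_sub_distrib, ← Finset.mul_sum, he]
    ring
  rw [e1, e2] at cs
  exact cs

/-- Pointwise coercivity. -/
theorem coercive (m p μ a : ℝ) (hm : 0 < m)
    (hcase : (0 < a ∧ p < 4 / m) ∨ a = 0 ∨ (a < 0 ∧ 0 < p)) (b : ℝ) (hμ : 0 ≤ μ) (hb : 0 ≤ b)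
    (hab : a < 0 → μ = 0 ∧ b = 0) :
    ∃ ε c : ℝ, 0 < ε ∧ ε < 1 ∧ 0 < c ∧ ∀ f s t : ℝ, 0 ≤ f → 0 < s → 0 < t →
      c * f ^ 2 ≤ (1 - ε) * (f + μ + a * s + b * t) ^ 2 - m * p * (a * s) * f := by
  rcases hcase with ⟨ha, hp⟩ | ha | ⟨ha, hp⟩
  · have hmp : p * m < 4 := by rwa [lt_div_iff₀ hm] at hp
    set θ := max (m * p / 4) 0 with hθ
    have h0 : 0 ≤ θ := le_max_right _ _
    have h1 : θ < 1 := max_lt (by nlinarith) one_pos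
    have h2 : m * p ≤ 4 * θ := by have := le_max_left (m * p / 4) 0; linarith
    refine ⟨(1 - θ) / 2, (1 - θ) / 2, by linarith, by linarith, by linarith, ?_⟩
    intro f s t hf hs ht
    have hA : 0 ≤ a * s := by positivity
    have hB : 0 ≤ b * t := by positivity
    generalize a * s = A at *
    generalize b * t = B at *
    have k1 : (f + A) ^ 2 ≤ (f + μ + A + B) ^ 2 := by
      apply pow_le_pow_left₀ <;> linarith
    have k2 : m * p * A * f ≤ θ * (f + A) ^ 2 := by
      have : m * p * (A * f) ≤ 4 * θ * (A * f) :=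
        mul_le_mul_of_nonneg_right h2 (by positivity)
      nlinarith [mul_nonneg h0 (sq_nonneg (f - A))]
    have k3 : f ^ 2 ≤ (f + A) ^ 2 := by gcongr; linarith
    have k4 := mul_le_mul_of_nonneg_left k1 (by linarith : 0 ≤ 1 - (1 - θ) / 2)
    have k5 := mul_le_mul_of_nonneg_left k3 (by linarith : 0 ≤ (1 - θ) / 2)
    linarith
  · refine ⟨1 / 2, 1 / 2, by norm_num, by norm_num, by norm_num, ?_⟩
    intro f s t hf hs ht
    have hB : 0 ≤ b * t := by positivity
    subst ha
    have k1 : f ^ 2 ≤ (f + μ + 0 * s + b * t) ^ 2 := by gcongr; linarith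
    linarith
  · obtain ⟨rfl, rfl⟩ := hab ha
    set k := min (1 / 2) (m * p / 4) with hk
    have hk0 : 0 < k := lt_min (by norm_num) (by positivity)
    have hk1 : k ≤ 1 / 2 := min_le_left _ _
    have hk2 : k ≤ m * p / 4 := min_le_right _ _
    refine ⟨1 / 2, k, by norm_num, by norm_num, hk0, ?_⟩
    intro f s t hf hs ht
    obtain ⟨D, hD⟩ : ∃ D, D = -(a * s) := ⟨_, rfl⟩
    have hD0 : 0 ≤ D := by rw [hD]; nlinarith
    have : a * s = -D := by linarith
    rw [this]
    have k1 := mul_le_mul_of_nonneg_right hk1 (sq_nonneg (f - D))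
    have k2 := mul_le_mul_of_nonneg_right hk2 (mul_nonneg hD0 hf)
    have k3 : k * f ^ 2 ≤ k * (f + D) ^ 2 := by gcongr; linarith
    nlinarith

theorem scalar_est {f ψ m y R Lf Hs S A B p q c ε K : ℝ} (hf : 0 < f) (hm : 0 < m)
    (hc : 0 < c) (hε : 0 < ε) (hqB : 0 ≤ q * B)
    (h1 : (y * ψ) ^ 2 ≤ R ^ 2 * f) (h2 : (S + 2 * y) ^ 2 ≤ m * Hs)
    (h3 : Lf = 2 * Hs - 2 * (4 * f * y) - 2 * (p * A - q * B) * f)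
    (h4 : ψ ^ 2 * Lf ≤ K * R ^ 2 * f)
    (h5 : c * f ^ 2 ≤ (1 - ε) * S ^ 2 - m * p * A * f) :
    ψ ^ 2 * f ≤ (2 / c) * (m * K / 2 + 4 / ε + 8 * m ^ 2 / c) * R ^ 2 := by
  have a1 : (1 - ε) * S ^ 2 - 4 / ε * y ^ 2 ≤ (S + 2 * y) ^ 2 := by
    have : (S + 2 * y) ^ 2 - ((1 - ε) * S ^ 2 - 4 / ε * y ^ 2) =
        (ε * S + 2 * y) ^ 2 / ε + 4 * y ^ 2 := by field_simp; ring
    have : 0 ≤ (ε * S + 2 * y) ^ 2 / ε + 4 * y ^ 2 := by positivity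
    linarith
  have a2 : 4 * m * f * y ≤ c / 2 * f ^ 2 + 8 * m ^ 2 / c * y ^ 2 := by
    have : c / 2 * f ^ 2 + 8 * m ^ 2 / c * y ^ 2 - 4 * m * f * y =
        (c * f - 4 * m * y) ^ 2 / (2 * c) := by field_simp; ring
    have : 0 ≤ (c * f - 4 * m * y) ^ 2 / (2 * c) := by positivity
    linarith
  have a3 : c / 2 * f ^ 2 - (4 / ε + 8 * m ^ 2 / c) * y ^ 2 ≤ m / 2 * Lf := by
    have : 0 ≤ m * (q * B) * f := by positivity
    rw [h3]
    nlinarith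
  have a4 := mul_le_mul_of_nonneg_left a3 (sq_nonneg ψ)
  have a5 := mul_le_mul_of_nonneg_left h4 (by positivity : 0 ≤ m / 2)
  have a6 := mul_le_mul_of_nonneg_left h1 (by positivity : 0 ≤ 4 / ε + 8 * m ^ 2 / c)
  have a7 : f * (c / 2 * (ψ ^ 2 * f)) ≤ f * ((m * K / 2 + 4 / ε + 8 * m ^ 2 / c) * R ^ 2) := by
    linarith
  have a8 := le_of_mul_le_mul_left a7 hf
  have a9 := mul_le_mul_of_nonneg_left a8 (by positivity : 0 ≤ 2 / c)
  calc ψ ^ 2 * f = 2 / c * (c / 2 * (ψ ^ 2 * f)) := by field_simp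
    _ ≤ _ := a9
    _ = _ := by ring

/-- Interior gradient estimate. -/
theorem grad_est {n : ℕ} (hn : 3 ≤ n) (μ a b p q : ℝ) (hb : 0 ≤ b) (hq : 1 ≤ q)
    {ε c : ℝ} (hε : 0 < ε) (hc : 0 < c)
    (hcoer : ∀ f s t : ℝ, 0 ≤ f → 0 < s → 0 < t →
      c * f ^ 2 ≤ (1 - ε) * (f + μ + a * s + b * t) ^ 2 - ((n : ℝ) - 1) * p * (a * s) * f)
    {w : EuclideanSpace ℝ (Fin n) → ℝ} (hw : Sm w)
    (hpde : ∀ x, lap w x = -((∑ i, pd i w x * pd i w x) + μ + a * exp (p * w x)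
      + b * exp (-q * w x))) :
    ∃ C : ℝ, ∀ R : ℝ, 0 < R → ∀ x : EuclideanSpace ℝ (Fin n), ∑ i, x i * x i ≤ R ^ 2 →
      (R ^ 2 - ∑ i, x i * x i) ^ 2 * (∑ i, pd i w x * pd i w x) ≤ C * R ^ 2 := by
  have hn' : (3 : ℝ) ≤ n := by exact_mod_cast hn
  set m : ℝ := (n : ℝ) - 1 with hmdef
  have hm : 0 < m := by linarith
  set K : ℝ := 24 + 4 * n with hK
  refine ⟨(2 / c) * (m * K / 2 + 4 / ε + 8 * m ^ 2 / c), fun R hR x hx => ?_⟩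
  have h1 : ∀ i, Sm (pd i w) := pd_smooth hw
  have h2 : ∀ i j, Sm (pd j (pd i w)) := fun i j => pd_smooth (h1 i) j
  obtain ⟨N, hN⟩ : ∃ N : EuclideanSpace ℝ (Fin n) → ℝ, N = fun y => ∑ i, y i * y i := ⟨_, rfl⟩
  obtain ⟨f, hf⟩ : ∃ f : EuclideanSpace ℝ (Fin n) → ℝ,
    f = fun y => ∑ i, pd i w y * pd i w y := ⟨_, rfl⟩
  have hNs : Sm N := by
    rw [hN]; exact ContDiff.sum fun i _ => (sm_coord i).mul (sm_coord i)
  have hfs : Sm f := by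
    rw [hf]; exact ContDiff.sum fun i _ => (h1 i).mul (h1 i)
  obtain ⟨ψ, hψ⟩ : ∃ ψ : EuclideanSpace ℝ (Fin n) → ℝ, ψ = fun y => R ^ 2 - N y := ⟨_, rfl⟩
  have hψs : Sm ψ := by rw [hψ]; exact contDiff_const.sub hNs
  obtain ⟨P, hP⟩ : ∃ P : EuclideanSpace ℝ (Fin n) → ℝ, P = fun y => ψ y * ψ y := ⟨_, rfl⟩
  have hPs : Sm P := by rw [hP]; exact hψs.mul hψs
  obtain ⟨G, hG⟩ : ∃ G : EuclideanSpace ℝ (Fin n) → ℝ, G = fun y => P y * f y := ⟨_, rfl⟩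
  have hGs : Sm G := by rw [hG]; exact hPs.mul hfs
  -- the maximum point
  have hset : {y : EuclideanSpace ℝ (Fin n) | N y ≤ R ^ 2} = Metric.closedBall 0 R := by
    ext y
    have hNy : N y = ‖y‖ ^ 2 := by
      rw [EuclideanSpace.real_norm_sq_eq, hN]
      exact Finset.sum_congr rfl fun i _ => by ring
    simp only [Set.mem_ofPred_eq, mem_closedBall_zero_iff, hNy]
    exact pow_le_pow_iff_left₀ (norm_nonneg _) hR.le (by norm_num)
  have hcomp : IsCompact {y : EuclideanSpace ℝ (Fin n) | N y ≤ R ^ 2} := by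
    rw [hset]; exact isCompact_closedBall _ _
  have hxm : x ∈ {y : EuclideanSpace ℝ (Fin n) | N y ≤ R ^ 2} := by
    simp only [Set.mem_ofPred_eq, hN]; exact hx
  obtain ⟨z, hz, hzmax⟩ := hcomp.exists_isMaxOn ⟨x, hxm⟩ hGs.continuous.continuousOn
  have hxz : G x ≤ G z := hzmax hxm
  have hgoal : (R ^ 2 - ∑ i, x i * x i) ^ 2 * (∑ i, pd i w x * pd i w x) = G x := by
    rw [hG, hP, hψ, hN, hf]; ring
  rw [hgoal]
  refine hxz.trans ?_
  have hGz : G z = ψ z ^ 2 * f z := by rw [hG, hP]; ring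
  have hfn : 0 ≤ f z := by
    rw [hf]; exact Finset.sum_nonneg fun i _ => mul_self_nonneg _
  rcases hfn.eq_or_lt with hf0 | hf0
  · rw [hGz, ← hf0]; simp only [mul_zero]; positivity
  have hψn : 0 ≤ ψ z := by rw [hψ]; simpa using hz
  rcases hψn.eq_or_lt with hψ0 | hψ0
  · rw [hGz, ← hψ0]; simp only [ne_eq, OfNat.ofNat_ne_zero, not_false_eq_true, zero_pow, zero_mul]
    positivity
  have hloc : IsLocalMax G z := by
    apply hzmax.isLocalMax
    have hop : IsOpen {y : EuclideanSpace ℝ (Fin n) | N y < R ^ 2} :=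
      isOpen_lt hNs.continuous continuous_const
    refine Filter.mem_of_superset (hop.mem_nhds ?_) fun y hy => by
      simp only [Set.mem_ofPred_eq] at hy ⊢
      exact hy.le
    simp only [hψ] at hψ0
    simp only [Set.mem_ofPred_eq]; linarith
  -- derivatives of the cutoff
  have dN : ∀ j y, pd j N y = 2 * y j := by
    intro j y
    rw [hN, pd_sum _ _ (fun i => (sm_coord i).mul (sm_coord i))]
    simp_rw [pd_mul (sm_coord _) (sm_coord _), pd_coord]
    simp [Finset.sum_add_distrib]; ring
  have dψ : ∀ j y, pd j ψ y = -2 * y j := by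
    intro j y
    rw [hψ, pd_sub contDiff_const hNs, pd_const, dN]; ring
  have dP : ∀ j, pd j P = fun y => -4 * (ψ y * y j) := by
    intro j; ext y
    rw [hP, pd_mul hψs hψs, dψ]; ring
  have ddP : ∀ j y, pd j (pd j P) y = 8 * y j ^ 2 - 4 * ψ y := by
    intro j y
    rw [dP, pd_cmul (hψs.mul (sm_coord j)), pd_mul hψs (sm_coord j), pd_coord, dψ]
    simp; ring
  have dG : ∀ j, pd j G = fun y => P y * pd j f y + f y * pd j P y := by
    intro j; ext y; rw [hG, pd_mul hPs hfs]
  have ddG : ∀ j y, pd j (pd j G) y =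
      P y * pd j (pd j f) y + 2 * (pd j P y * pd j f y) + f y * pd j (pd j P) y := by
    intro j y
    rw [dG, pd_add (hPs.mul (pd_smooth hfs j)) (hfs.mul (pd_smooth hPs j)),
      pd_mul hPs (pd_smooth hfs j), pd_mul hfs (pd_smooth hPs j)]
    ring
  have c1 : ∀ j, ψ z * pd j f z = 4 * f z * z j := by
    intro j
    have := (pd_max hGs hloc j).1
    rw [dG, dP, hP] at this
    have h3 : ψ z * (ψ z * pd j f z - 4 * f z * z j) = 0 := by simp only at this; linarith
    rcases mul_eq_zero.1 h3 with h | h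
    · exact absurd h hψ0.ne'
    · linarith
  have c2 : ∀ j, ψ z ^ 2 * pd j (pd j f) z ≤ 24 * f z * (z j * z j) + 4 * ψ z * f z := by
    intro j
    have := (pd_max hGs hloc j).2
    rw [ddG, ddP, dP, hP] at this
    simp only at this
    have h3 : -4 * (ψ z * z j) * pd j f z = -16 * f z * (z j * z j) := by
      have := c1 j
      linear_combination (-4 * z j) * this
    rw [h3] at this
    linarith
  have hNz : N z ≤ R ^ 2 := hz
  have hNz0 : 0 ≤ N z := by
    rw [hN]; exact Finset.sum_nonneg fun i _ => mul_self_nonneg _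
  have hψR : ψ z ≤ R ^ 2 := by rw [hψ]; simp only; linarith
  have c3 : ψ z ^ 2 * lap f z ≤ K * R ^ 2 * f z := by
    rw [lap_eq, Finset.mul_sum]
    refine (Finset.sum_le_sum fun j _ => c2 j).trans ?_
    rw [Finset.sum_add_distrib, ← Finset.mul_sum]
    have : ∑ i, z i * z i = N z := by rw [hN]
    rw [this]
    simp only [Finset.sum_const, Finset.card_univ, Fintype.card_fin, nsmul_eq_mul]
    have k1 : f z * N z ≤ f z * R ^ 2 := by gcongr
    have k2 : (n : ℝ) * (f z * ψ z) ≤ n * (f z * R ^ 2) := by gcongr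
    rw [hK]; linarith
  -- the quantity y
  obtain ⟨Y, hY⟩ : ∃ Y : ℝ, Y = ∑ i, z i * pd i w z := ⟨_, rfl⟩
  have hfz : ∑ i, pd i w z * pd i w z = f z := by rw [hf]
  have hYsq : Y ^ 2 ≤ R ^ 2 * f z := by
    have := Finset.sum_mul_sq_le_sq_mul_sq Finset.univ (fun i => z i) (fun i => pd i w z)
    simp only [pow_two (z _), pow_two (pd _ w z)] at this
    rw [← hY, hfz] at this
    have h3 : ∑ i, z i * z i = N z := by rw [hN]
    rw [h3] at this
    exact this.trans (by gcongr)
  have c4 : ∑ j, pd j w z * pd j f z = 4 * f z * (Y / ψ z) := by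
    have : ψ z * ∑ j, pd j w z * pd j f z = 4 * f z * Y := by
      rw [Finset.mul_sum, hY, Finset.mul_sum]
      refine Finset.sum_congr rfl fun j _ => ?_
      linear_combination (pd j w z) * c1 j
    field_simp
    linarith
  have df : ∀ j, pd j f z = 2 * ∑ i, pd i w z * pd j (pd i w) z := by
    intro j
    rw [hf, pd_sum _ _ (fun k => (h1 k).mul (h1 k)), Finset.mul_sum]
    refine Finset.sum_congr rfl fun i _ => ?_
    rw [pd_mul (h1 i) (h1 i)]; ring
  have c5 : ∑ i, ∑ j, pd i w z * pd j w z * pd j (pd i w) z = 2 * f z * (Y / ψ z) := by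
    have : ∑ j, pd j w z * pd j f z =
        2 * ∑ i, ∑ j, pd i w z * pd j w z * pd j (pd i w) z := by
      rw [Finset.sum_comm, Finset.mul_sum]
      refine Finset.sum_congr rfl fun j _ => ?_
      rw [df, Finset.mul_sum, Finset.mul_sum, Finset.mul_sum]
      refine Finset.sum_congr rfl fun i _ => ?_
      ring
    linarith
  have hsq : √(f z) * √(f z) = f z := mul_self_sqrt hfn
  have c6 := hess_ineq (fun i j => pd j (pd i w) z) (fun i => pd i w z / √(f z)) (by
    simp_rw [div_mul_div_comm, hsq, ← Finset.sum_div, hfz]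
    exact div_self hf0.ne')
  have c7 : ∑ i, ∑ j, pd i w z / √(f z) * (pd j w z / √(f z)) * pd j (pd i w) z
      = 2 * (Y / ψ z) := by
    simp_rw [div_mul_div_comm, hsq, div_mul_eq_mul_div, ← Finset.sum_div, c5]
    field_simp
  rw [c7, ← lap_eq, hpde, hfz] at c6
  have c8 := bochner hw z
  rw [← hf] at c8
  have dl : ∀ i, pd i (lap w) z = -(pd i f z + a * (exp (p * w z) * (p * pd i w z))
      + b * (exp (-q * w z) * (-q * pd i w z))) := by
    intro i
    have hl : lap w = fun y => -(f y + μ + a * exp (p * w y) + b * exp (-q * w y)) := by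
      ext y; rw [hpde, hf]
    have s1 : ∀ r : ℝ, Sm (fun y => r * w y) := fun r => contDiff_const.mul hw
    have s2 : ∀ r : ℝ, Sm (fun y => exp (r * w y)) := fun r => (s1 r).exp
    rw [hl, pd_neg, pd_add ((hfs.add contDiff_const).add (contDiff_const.mul (s2 p)))
      (contDiff_const.mul (s2 (-q))), pd_add (hfs.add contDiff_const) (contDiff_const.mul (s2 p)),
      pd_add hfs contDiff_const, pd_const, pd_cmul (s2 p), pd_cmul (s2 (-q)), pd_exp (s1 p),
      pd_exp (s1 (-q)), pd_cmul hw, pd_cmul hw]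
    ring
  have c9 : ∑ i, pd i w z * pd i (lap w) z = -(4 * f z * (Y / ψ z))
      - (p * (a * exp (p * w z)) - q * (b * exp (-q * w z))) * f z := by
    rw [← c4, ← hfz, Finset.mul_sum, ← Finset.sum_neg_distrib, ← Finset.sum_sub_distrib]
    refine Finset.sum_congr rfl fun i _ => ?_
    rw [dl]; ring
  rw [c9] at c8
  rw [hGz]
  refine scalar_est (y := Y / ψ z) (Lf := lap f z)
    (Hs := ∑ i, ∑ j, pd j (pd i w) z ^ 2)
    (S := f z + μ + a * exp (p * w z) + b * exp (-q * w z)) (A := a * exp (p * w z))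
    (B := b * exp (-q * w z)) (p := p) (q := q) hf0 hm hc hε ?_ ?_ ?_ ?_ c3 ?_
  · positivity
  · rw [div_mul_cancel₀ _ hψ0.ne']; exact hYsq
  · refine le_trans (le_of_eq ?_) c6; ring
  · rw [c8]; ring
  · exact hcoer _ _ _ hfn (exp_pos _) (exp_pos _)

theorem stmt_2 (n : ℕ) (hn : 3 ≤ n) (μ a b p q : ℝ)
    (hμ : 0 ≤ μ) (hb : 0 ≤ b) (hq : 1 ≤ q)
    (hcase : (0 < a ∧ -1 ≤ p ∧ p < 4 / ((n : ℝ) - 1)) ∨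
             (a = 0 ∧ μ + b ≠ 0 ∧ -1 ≤ p) ∨
             (a < 0 ∧ b = 0 ∧ μ = 0 ∧ 0 < p)) :
    ¬ ∃ v : EuclideanSpace ℝ (Fin n) → ℝ, ContDiff ℝ (⊤ : ℕ∞) v ∧
        (∀ x, 0 < v x) ∧
        (∀ x, lap v x + μ * v x + a * v x ^ (p + 1) + b * v x ^ (1 - q) = 0) := by
  rintro ⟨v, hv, hpos, heq⟩
  have hn' : (3 : ℝ) ≤ n := by exact_mod_cast hn
  obtain ⟨w, hwdef⟩ : ∃ w : EuclideanSpace ℝ (Fin n) → ℝ, w = fun y => log (v y) := ⟨_, rfl⟩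
  have hw : Sm w := by rw [hwdef]; exact hv.log fun y => (hpos y).ne'
  have hvw : v = fun y => exp (w y) := by
    ext y; rw [hwdef]; exact (exp_log (hpos y)).symm
  have dv : ∀ i, pd i v = fun y => v y * pd i w y := by
    intro i; ext y
    conv_lhs => rw [hvw]
    rw [pd_exp hw]
    conv_rhs => rw [hvw]
  have ddv : ∀ i y, pd i (pd i v) y = v y * (pd i w y * pd i w y) + v y * pd i (pd i w) y := by
    intro i y
    rw [dv, pd_mul hv (pd_smooth hw i), dv]; ring
  have hlap : ∀ y, lap v y = v y * (∑ i, pd i w y * pd i w y) + v y * lap w y := by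
    intro y
    rw [lap_eq, lap_eq, Finset.mul_sum, Finset.mul_sum, ← Finset.sum_add_distrib]
    exact Finset.sum_congr rfl fun i _ => ddv i y
  have hr1 : ∀ y, v y ^ (p + 1) = v y * exp (p * w y) := by
    intro y
    rw [rpow_add_one (hpos y).ne', rpow_def_of_pos (hpos y), hwdef]; ring_nf
  have hr2 : ∀ y, v y ^ (1 - q) = v y * exp (-q * w y) := by
    intro y
    rw [show 1 - q = -q + 1 by ring, rpow_add_one (hpos y).ne', rpow_def_of_pos (hpos y), hwdef]
    ring_nf
  have hpde : ∀ x, lap w x = -((∑ i, pd i w x * pd i w x) + μ + a * exp (p * w x)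
      + b * exp (-q * w x)) := by
    intro x
    have := heq x
    rw [hlap, hr1, hr2] at this
    have h3 : v x * (lap w x + ((∑ i, pd i w x * pd i w x) + μ + a * exp (p * w x)
      + b * exp (-q * w x))) = 0 := by linarith
    rcases mul_eq_zero.1 h3 with h | h
    · exact absurd h (hpos x).ne'
    · linarith
  obtain ⟨ε, c, hε, -, hc, hcoer⟩ := coercive ((n : ℝ) - 1) p μ a (by linarith)
    (by
      rcases hcase with h | h | h
      · exact Or.inl ⟨h.1, h.2.2⟩
      · exact Or.inr (Or.inl h.1)
      · exact Or.inr (Or.inr ⟨h.1, h.2.2.2⟩)) b hμ hb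
    (by
      intro ha
      rcases hcase with h | h | h
      · linarith [h.1]
      · linarith [h.1]
      · exact ⟨h.2.2.1, h.2.1⟩)
  obtain ⟨C, hC⟩ := grad_est hn μ a b p q hb hq hε hc hcoer hw hpde
  have hzero : ∀ x, ∑ i, pd i w x * pd i w x = 0 := by
    intro x
    have hf0 : 0 ≤ ∑ i, pd i w x * pd i w x := Finset.sum_nonneg fun i _ => mul_self_nonneg _
    have hN0 : 0 ≤ ∑ i, x i * x i := Finset.sum_nonneg fun i _ => mul_self_nonneg _
    have hC' := fun R hR => hC R hR x
    generalize ∑ i, pd i w x * pd i w x = F at *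
    generalize ∑ i, x i * x i = N at *
    by_contra hne
    have hF : 0 < F := lt_of_le_of_ne hf0 (Ne.symm hne)
    -- choose a large radius
    set T : ℝ := 2 * N + 1 + 4 * |C| / F with hT
    have hCF : 0 ≤ 4 * |C| / F := by positivity
    have hT1 : 0 < T := by linarith
    have hs : √T ^ 2 = T := sq_sqrt hT1.le
    have h3 := hC' (√T) (sqrt_pos.2 hT1) (by rw [hs]; linarith)
    rw [hs] at h3
    have h4 : (T / 2) ^ 2 ≤ (T - N) ^ 2 := by
      apply pow_le_pow_left₀ <;> linarith
    have h5 : (T / 2) ^ 2 * F ≤ C * T := (mul_le_mul_of_nonneg_right h4 hf0).trans h3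
    have h6 : T * (T * F) ≤ T * (4 * C) := by linarith
    have h7 := le_of_mul_le_mul_left h6 hT1
    have h8 : T * F = (2 * N + 1) * F + 4 * |C| := by rw [hT]; field_simp
    have h9 : 0 < (2 * N + 1) * F := by positivity
    linarith [le_abs_self C]
  have hpz : ∀ i, pd i w = fun _ => 0 := by
    intro i; ext x
    have := (Finset.sum_eq_zero_iff_of_nonneg (fun i _ => mul_self_nonneg (pd i w x))).1 (hzero x)
      i (Finset.mem_univ i)
    exact mul_self_eq_zero.1 this
  have hl0 : lap w 0 = 0 := by
    rw [lap_eq]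
    refine Finset.sum_eq_zero fun i _ => ?_
    rw [hpz, pd_const]
  have hfin := hpde 0
  rw [hl0, hzero] at hfin
  have e1 := exp_pos (p * w 0)
  have e2 := exp_pos (-q * w 0)
  have e3 : 0 ≤ b * exp (-q * w 0) := by positivity
  rcases hcase with ⟨ha, -⟩ | ⟨rfl, hne, -⟩ | ⟨ha, rfl, rfl, -⟩
  · have : 0 < a * exp (p * w 0) := by positivity
    linarith
  · have hm0 : μ = 0 := by linarith
    have hb0 : b * exp (-q * w 0) = 0 := by linarith
    have : b = 0 := by
      rcases mul_eq_zero.1 hb0 with h | h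
      · exact h
      · exact absurd h e2.ne'
    exact hne (by rw [hm0, this]; ring)
  · have : a * exp (p * w 0) < 0 := mul_neg_of_neg_of_pos ha e1
    linarith
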